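/- arXiv:nlin/0504005 — 2 statements merged into one kernel-verified Lean document; each statement's English description precedes it below -/
import Mathlib

section
/- Let β > 0. Let X and Y be independent random variables, each exponentially distributed with rate β, and let U be uniformly distributed on [0,1], independent of (X,Y). Then the pair (U·(X+Y), (1−U)·(X+Y)) has the same joint distribution as (X,Y); i.e., the random-halves energy exchange maps two independent exponential(β) energies to two independent exponential(β) energies. -/
open MeasureTheory ProbabilityTheory

/-- The exponential law with rate β, as a measure on ℝ. -/
noncomputable def expLaw (β : ℝ) : Measure ℝ :=
  volume.withDensity fun x => ENNReal.ofReal (if 0 < x then β * Real.exp (-β * x) else 0)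

/-- density -/
noncomputable def expDens (β : ℝ) (x : ℝ) : ENNReal :=
  ENNReal.ofReal (if 0 < x then β * Real.exp (-β * x) else 0)

lemma measurable_expDens (β : ℝ) : Measurable (expDens β) := by
  unfold expDens
  refine ENNReal.measurable_ofReal.comp (Measurable.ite measurableSet_Ioi ?_ measurable_const)
  fun_prop

lemma expLaw_eq (β : ℝ) : expLaw β = volume.withDensity (expDens β) := rfl

instance (β : ℝ) : SFinite (expLaw β) := by rw [expLaw_eq]; infer_instance

lemma expDens_mul (β : ℝ) (hβ : 0 < β) (s u : ℝ) (hs : 0 < s) :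
    expDens β (s * u) * expDens β (s - s * u)
      = (Set.Ioo (0:ℝ) 1).indicator (fun _ => ENNReal.ofReal (β ^ 2 * Real.exp (-β * s))) u := by
  unfold expDens
  by_cases h0 : 0 < u
  · by_cases h1 : u < 1
    · have hp : 0 < s * u := by positivity
      have hq : 0 < s - s * u := by nlinarith
      rw [Set.indicator_of_mem (show u ∈ Set.Ioo (0:ℝ) 1 from ⟨h0, h1⟩), if_pos hp, if_pos hq,
        ← ENNReal.ofReal_mul (by positivity)]
      congr 1
      rw [show -β * s = -β * (s * u) + -β * (s - s * u) by ring, Real.exp_add]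
      ring
    · have hq : ¬ 0 < s - s * u := by nlinarith
      rw [Set.indicator_of_notMem (fun h => h1 h.2), if_neg hq]
      simp
  · have hq : ¬ 0 < s * u := by nlinarith
    rw [Set.indicator_of_notMem (fun h => h0 h.1), if_neg hq]
    simp

lemma inner_eq (β : ℝ) (hβ : 0 < β) (F : ℝ × ℝ → ENNReal) (hF : Measurable F) (s : ℝ) :
    ∫⁻ x, expDens β x * (expDens β (s - x) * F (x, s - x))
      = ENNReal.ofReal s * ENNReal.ofReal (β ^ 2 * Real.exp (-β * s)) *
        ∫⁻ u in Set.Icc (0:ℝ) 1, F (u * s, (1 - u) * s) := by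
  have hd := measurable_expDens β
  rcases le_or_gt s 0 with hs | hs
  · rw [ENNReal.ofReal_of_nonpos hs, zero_mul, zero_mul]
    rw [lintegral_eq_zero_iff (by fun_prop)]
    refine Filter.Eventually.of_forall fun x => ?_
    rcases le_or_gt x 0 with hx | hx
    · simp [expDens, not_lt.mpr hx]
    · have : ¬ x < s := by linarith
      simp [expDens, this]
  · have hv := Real.smul_map_volume_mul_left hs.ne'
    have hm : Measurable fun u : ℝ => F (u * s, (1 - u) * s) := by fun_prop
    conv_lhs => rw [← hv]
    rw [lintegral_smul_measure, lintegral_map (by fun_prop) (by fun_prop), abs_of_pos hs,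
      smul_eq_mul, mul_assoc, ← lintegral_const_mul _ hm,
      ← Measure.restrict_congr_set Ioo_ae_eq_Icc, ← lintegral_indicator measurableSet_Ioo]
    congr 1
    refine lintegral_congr fun u => ?_
    rw [← mul_assoc, expDens_mul β hβ s u hs]
    by_cases h : u ∈ Set.Ioo (0:ℝ) 1
    · simp only [Set.indicator_of_mem h]
      rw [show s * u = u * s by ring, show s - u * s = (1 - u) * s by ring]
    · simp only [Set.indicator_of_notMem h, zero_mul]

lemma prod_eq (β : ℝ) (hβ : 0 < β) (F : ℝ × ℝ → ENNReal) (hF : Measurable F) :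
    ∫⁻ z, F z ∂((expLaw β).prod (expLaw β))
      = ∫⁻ s, ENNReal.ofReal s * ENNReal.ofReal (β ^ 2 * Real.exp (-β * s)) *
        ∫⁻ u in Set.Icc (0:ℝ) 1, F (u * s, (1 - u) * s) := by
  have hd := measurable_expDens β
  rw [lintegral_prod _ hF.aemeasurable, expLaw_eq,
    lintegral_withDensity_eq_lintegral_mul _ hd
      (by rw [← expLaw_eq]; exact hF.lintegral_prod_right')]
  have : ∀ x, (expDens β * fun x => ∫⁻ y, F (x, y) ∂(volume.withDensity (expDens β))) x
      = ∫⁻ s, expDens β x * (expDens β (s - x) * F (x, s - x)) := by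
    intro x
    rw [Pi.mul_apply, lintegral_withDensity_eq_lintegral_mul _ hd (by fun_prop),
      lintegral_const_mul _ (by fun_prop)]
    congr 1
    exact (lintegral_sub_right_eq_self (fun y => expDens β y * F (x, y)) x).symm
  rw [lintegral_congr this, lintegral_lintegral_swap (by fun_prop)]
  exact lintegral_congr fun s => inner_eq β hβ F hF s

/-- The random-halves energy exchange maps two independent exponential(β)
energies to two independent exponential(β) energies: if X, Y are independent
exponential(β) and U is uniform on [0,1] independent of (X,Y), then
(U(X+Y), (1−U)(X+Y)) has the same joint law as (X,Y). -/
theorem stmt3 {Ω : Type*} [MeasurableSpace Ω] (μ : Measure Ω) [IsProbabilityMeasure μ]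
    (β : ℝ) (hβ : 0 < β) (X Y U : Ω → ℝ)
    (hX : Measurable X) (hY : Measurable Y) (hU : Measurable U)
    (hXlaw : Measure.map X μ = expLaw β) (hYlaw : Measure.map Y μ = expLaw β)
    (hUlaw : Measure.map U μ = volume.restrict (Set.Icc (0:ℝ) 1))
    (hXY : IndepFun X Y μ)
    (hUXY : IndepFun U (fun ω => (X ω, Y ω)) μ) :
    Measure.map (fun ω => (U ω * (X ω + Y ω), (1 - U ω) * (X ω + Y ω))) μ
      = Measure.map (fun ω => (X ω, Y ω)) μ := by
  have := Measure.isProbabilityMeasure_map (μ := μ) hU.aemeasurable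
  have h1 : Measure.map (fun ω => (X ω, Y ω)) μ = (expLaw β).prod (expLaw β) := by
    rw [(indepFun_iff_map_prod_eq_prod_map_map hX.aemeasurable hY.aemeasurable).1 hXY,
      hXlaw, hYlaw]
  have h2 : Measure.map (fun ω => (U ω, (X ω, Y ω))) μ
      = (volume.restrict (Set.Icc (0:ℝ) 1)).prod ((expLaw β).prod (expLaw β)) := by
    rw [(indepFun_iff_map_prod_eq_prod_map_map hU.aemeasurable
      (hX.prodMk hY).aemeasurable).1 hUXY, hUlaw, h1]
  refine Measure.ext_of_lintegral _ fun F hF => ?_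
  have hT : Measurable fun p : ℝ × ℝ × ℝ =>
      F (p.1 * (p.2.1 + p.2.2), (1 - p.1) * (p.2.1 + p.2.2)) := by fun_prop
  have hG : Measurable fun z : ℝ × ℝ =>
      ∫⁻ u in Set.Icc (0:ℝ) 1, F (u * (z.1 + z.2), (1 - u) * (z.1 + z.2)) :=
    Measurable.lintegral_prod_left' (f := fun p : ℝ × ℝ × ℝ =>
      F (p.1 * (p.2.1 + p.2.2), (1 - p.1) * (p.2.1 + p.2.2))) hT
  have h3 : ∫⁻ z, F z ∂(Measure.map
        (fun ω => (U ω * (X ω + Y ω), (1 - U ω) * (X ω + Y ω))) μ)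
      = ∫⁻ p, F (p.1 * (p.2.1 + p.2.2), (1 - p.1) * (p.2.1 + p.2.2))
        ∂(Measure.map (fun ω => (U ω, (X ω, Y ω))) μ) := by
    rw [lintegral_map hF (by fun_prop), lintegral_map hT (by fun_prop)]
  rw [h3, h2, h1, lintegral_prod_symm _ hT.aemeasurable, prod_eq β hβ _ hG, prod_eq β hβ F hF]
  refine lintegral_congr fun s => ?_
  congr 1
  have : ∀ u : ℝ, u * s + (1 - u) * s = s := fun u => by ring
  simp [this]
end

section
/- Let β > 0. Let X be exponentially distributed with rate β and let Y be independent of X with density √(β/(πy)) e^{-βy} on (0,∞). Set S = X + Y. Let Y' be a random variable whose conditional density given S = s is 1/(2√(y' s)) on [0,s], and set X' = S − Y'. Then: (1) S has density (2β^{3/2}/√π)·√s·e^{-βs} on (0,∞) (the Gamma(3/2,β) law); (2) the pair (X', Y') has the same joint distribution as (X, Y), i.e., X' is exponential with rate β, Y' has density √(β/(πy'))e^{-βy'}, and X', Y' are independent. -/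
open MeasureTheory ProbabilityTheory

/-- The stationary tracer-energy law, with density √(β/(πy)) e^{-βy} on (0,∞). -/
noncomputable def tracerLaw (β : ℝ) : Measure ℝ :=
  volume.withDensity fun y =>
    ENNReal.ofReal (if 0 < y then Real.sqrt (β / (Real.pi * y)) * Real.exp (-β * y) else 0)

/-- The Gamma(3/2, β) law, with density (2β^{3/2}/√π) √s e^{-βs} on (0,∞). -/
noncomputable def gammaThreeHalfLaw (β : ℝ) : Measure ℝ :=
  volume.withDensity fun s =>
    ENNReal.ofReal (if 0 < s then
      (2 * β ^ ((3:ℝ)/2) / Real.sqrt Real.pi) * Real.sqrt s * Real.exp (-β * s) else 0)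

/-- The exponential density. -/
noncomputable def fD (β : ℝ) (x : ℝ) : ENNReal :=
  ENNReal.ofReal (if 0 < x then β * Real.exp (-β * x) else 0)

/-- The tracer density. -/
noncomputable def gD (β : ℝ) (y : ℝ) : ENNReal :=
  ENNReal.ofReal (if 0 < y then Real.sqrt (β / (Real.pi * y)) * Real.exp (-β * y) else 0)

/-- The Gamma density. -/
noncomputable def hD (β : ℝ) (s : ℝ) : ENNReal :=
  ENNReal.ofReal (if 0 < s then
      (2 * β ^ ((3:ℝ)/2) / Real.sqrt Real.pi) * Real.sqrt s * Real.exp (-β * s) else 0)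

lemma meas_fD (β : ℝ) : Measurable (fD β) := by
  unfold fD
  refine ENNReal.measurable_ofReal.comp (Measurable.ite measurableSet_Ioi ?_ ?_) <;> fun_prop

lemma meas_gD (β : ℝ) : Measurable (gD β) := by
  unfold gD
  refine ENNReal.measurable_ofReal.comp (Measurable.ite measurableSet_Ioi ?_ ?_) <;> fun_prop

lemma meas_hD (β : ℝ) : Measurable (hD β) := by
  unfold hD
  refine ENNReal.measurable_ofReal.comp (Measurable.ite measurableSet_Ioi ?_ ?_) <;> fun_prop

lemma kernel_eq (s : ℝ) (hs : 0 < s) (y : ℝ) (hy : y ∈ Set.Icc 0 s) :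
    1 / (2 * Real.sqrt (y * s)) = (1 / (2 * Real.sqrt s)) * y ^ (-(1/2) : ℝ) := by
  rw [Real.rpow_neg hy.1, ← Real.sqrt_eq_rpow, Real.sqrt_mul hy.1]
  simp only [one_div, mul_inv]
  ring

lemma kernel_integrable (s : ℝ) (hs : 0 < s) :
    IntegrableOn (fun y => 1 / (2 * Real.sqrt (y * s))) (Set.Icc 0 s) := by
  have h := (intervalIntegral.intervalIntegrable_rpow' (a := 0) (b := s)
    (r := (-(1/2) : ℝ)) (by norm_num)).const_mul (1 / (2 * Real.sqrt s))
  rw [intervalIntegrable_iff_integrableOn_Icc_of_le hs.le] at h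
  exact h.congr_fun (fun y hy => (kernel_eq s hs y hy).symm) measurableSet_Icc

lemma kernel_mass (s : ℝ) (hs : 0 < s) :
    ∫ y in Set.Icc 0 s, 1 / (2 * Real.sqrt (y * s)) = 1 := by
  rw [setIntegral_congr_fun measurableSet_Icc (fun y hy => kernel_eq s hs y hy),
    integral_Icc_eq_integral_Ioc, ← intervalIntegral.integral_of_le hs.le,
    intervalIntegral.integral_const_mul, integral_rpow (by left; norm_num)]
  have h1 : (-(1/2) + 1 : ℝ) = 1/2 := by norm_num
  rw [h1, ← Real.sqrt_eq_rpow, ← Real.sqrt_eq_rpow]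
  have : 0 < Real.sqrt s := Real.sqrt_pos.2 hs
  simp
  field_simp

lemma dens_eq (β : ℝ) (hβ : 0 < β) (s y : ℝ) (hy : 0 < y) (hys : y < s) :
    fD β (s - y) * gD β y = hD β s * ENNReal.ofReal (1 / (2 * Real.sqrt (y * s))) := by
  have hs : 0 < s := hy.trans hys
  unfold fD gD hD
  rw [if_pos (sub_pos.2 hys), if_pos hy, if_pos hs, ← ENNReal.ofReal_mul (by positivity),
    ← ENNReal.ofReal_mul (by positivity)]
  congr 1
  have e : Real.exp (-β * s) = Real.exp (-β * (s - y)) * Real.exp (-β * y) := by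
    rw [← Real.exp_add]; congr 1; ring
  have hb : β ^ ((3:ℝ)/2) = β * Real.sqrt β := by
    rw [Real.sqrt_eq_rpow, ← Real.rpow_one_add' hβ.le (by norm_num)]; norm_num
  rw [e, hb, Real.sqrt_div hβ.le, Real.sqrt_mul Real.pi_pos.le, Real.sqrt_mul hy.le]
  have := Real.sqrt_pos.2 hs
  have := Real.sqrt_pos.2 hy
  have := Real.sqrt_pos.2 Real.pi_pos
  field_simp

lemma fiber (β : ℝ) (hβ : 0 < β) (B : Set ℝ) (hB : MeasurableSet B) (s : ℝ) :
    ∫⁻ y in B, fD β (s - y) * gD β y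
      = hD β s * ENNReal.ofReal (∫ y in B ∩ Set.Icc 0 s, 1 / (2 * Real.sqrt (y * s))) := by
  rcases le_or_gt s 0 with hs | hs
  · have h0 : ∀ y, fD β (s - y) * gD β y = 0 := by
      intro y
      rcases le_or_gt y 0 with hy | hy
      · simp [gD, not_lt.2 hy]
      · simp [fD, not_lt.2 (show s ≤ y by linarith)]
    simp [h0, hD, not_lt.2 hs]
  · rw [ofReal_integral_eq_lintegral_ofReal
      ((kernel_integrable s hs).mono_set Set.inter_subset_right)
      (Filter.Eventually.of_forall fun y => by positivity),
      ← lintegral_const_mul _ (by fun_prop), Set.inter_comm,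
      ← Measure.restrict_restrict measurableSet_Icc, ← lintegral_indicator measurableSet_Icc]
    apply lintegral_congr_ae
    apply ae_restrict_of_ae
    have h0 : ∀ᵐ y : ℝ, y ≠ 0 := by simp [ae_iff]
    have h1 : ∀ᵐ y : ℝ, y ≠ s := by simp [ae_iff]
    filter_upwards [h0, h1] with y hy0 hys
    by_cases hy : y ∈ Set.Icc 0 s
    · rw [Set.indicator_of_mem hy]
      exact dens_eq β hβ s y (lt_of_le_of_ne hy.1 hy0.symm) (lt_of_le_of_ne hy.2 hys)
    · rw [Set.indicator_of_notMem hy]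
      rcases le_or_gt y 0 with hy' | hy'
      · simp [gD, not_lt.2 hy']
      · have : s ≤ y := by
          by_contra hc
          exact hy ⟨hy'.le, by linarith⟩
        simp [fD, not_lt.2 this]

lemma joint {Ω : Type*} [MeasurableSpace Ω] (μ : Measure Ω) [IsProbabilityMeasure μ]
    (β : ℝ) (hβ : 0 < β) (X Y : Ω → ℝ)
    (hX : Measurable X) (hY : Measurable Y)
    (hXlaw : Measure.map X μ = expLaw β) (hYlaw : Measure.map Y μ = tracerLaw β)
    (hXY : IndepFun X Y μ) (A B : Set ℝ) (hA : MeasurableSet A) (hB : MeasurableSet B) :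
    Measure.map (fun ω => (X ω + Y ω, Y ω)) μ (A ×ˢ B)
      = ∫⁻ s in A, hD β s *
          ENNReal.ofReal (∫ y in B ∩ Set.Icc 0 s, 1 / (2 * Real.sqrt (y * s))) := by
  have hf := meas_fD β
  have hg := meas_gD β
  have hprod := (indepFun_iff_map_prod_eq_prod_map_map hX.aemeasurable hY.aemeasurable).1 hXY
  have : IsProbabilityMeasure (expLaw β) :=
    hXlaw ▸ Measure.isProbabilityMeasure_map hX.aemeasurable
  have : IsProbabilityMeasure (tracerLaw β) :=
    hYlaw ▸ Measure.isProbabilityMeasure_map hY.aemeasurable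
  have hT : Measurable (fun p : ℝ × ℝ => (p.1 + p.2, p.2)) := by fun_prop
  have hcomp : Measure.map (fun ω => (X ω + Y ω, Y ω)) μ
      = Measure.map (fun p : ℝ × ℝ => (p.1 + p.2, p.2)) ((expLaw β).prod (tracerLaw β)) := by
    rw [← hXlaw, ← hYlaw, ← hprod, Measure.map_map hT (hX.prodMk hY)]
    rfl
  have hAB := hA.prod hB
  rw [hcomp, Measure.map_apply hT hAB, Measure.prod_apply_symm (hT hAB)]
  have hm : Measurable fun y => expLaw β
      ((fun x => (x, y)) ⁻¹' ((fun p : ℝ × ℝ => (p.1 + p.2, p.2)) ⁻¹' (A ×ˢ B))) :=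
    measurable_measure_prodMk_right (hT hAB)
  have ht : tracerLaw β = volume.withDensity (gD β) := rfl
  have he : expLaw β = volume.withDensity (fD β) := rfl
  rw [ht, lintegral_withDensity_eq_lintegral_mul _ hg hm]
  have key : ∀ y, (gD β * fun y => expLaw β
      ((fun x => (x, y)) ⁻¹' ((fun p : ℝ × ℝ => (p.1 + p.2, p.2)) ⁻¹' (A ×ˢ B)))) y
      = B.indicator (fun y => ∫⁻ s in A, fD β (s - y) * gD β y) y := by
    intro y
    by_cases hy : y ∈ B
    · rw [Set.indicator_of_mem hy, Pi.mul_apply]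
      have hset : ((fun x => (x, y)) ⁻¹' ((fun p : ℝ × ℝ => (p.1 + p.2, p.2)) ⁻¹' (A ×ˢ B)))
          = (fun x => x + y) ⁻¹' A := by
        ext x; simp [hy]
      have hA' : MeasurableSet ((fun x : ℝ => x + y) ⁻¹' A) := (measurable_add_const y) hA
      rw [hset, he, withDensity_apply _ hA', ← lintegral_indicator hA', ← lintegral_indicator hA,
        ← lintegral_const_mul _ (hf.indicator hA'),
        ← lintegral_add_right_eq_self (A.indicator fun s => fD β (s - y) * gD β y) y]
      refine lintegral_congr fun x => ?_
      by_cases hx : x + y ∈ A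
      · rw [Set.indicator_of_mem hx, Set.indicator_of_mem (show x ∈ (fun x : ℝ => x + y) ⁻¹' A from hx)]
        simp [mul_comm]
      · rw [Set.indicator_of_notMem hx, Set.indicator_of_notMem (show x ∉ (fun x : ℝ => x + y) ⁻¹' A from hx)]
        simp
    · rw [Set.indicator_of_notMem hy, Pi.mul_apply]
      have hset : ((fun x => (x, y)) ⁻¹' ((fun p : ℝ × ℝ => (p.1 + p.2, p.2)) ⁻¹' (A ×ˢ B)))
          = ∅ := by
        ext x; simp [hy]
      simp [hset]
  rw [lintegral_congr key, lintegral_indicator hB, lintegral_lintegral_swap]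
  · exact lintegral_congr fun s => fiber β hβ B hB s
  · apply Measurable.aemeasurable
    exact (hf.comp (measurable_snd.sub measurable_fst)).mul (hg.comp measurable_fst)

/-- Fixed-point property of the energy-exchange rule of Sect. 3.6: if X is
exponential(β), Y has the tracer-energy law, X and Y are independent, S = X + Y,
and Y' has conditional density 1/(2√(y'S)) on [0,S] given S, X' = S − Y', then
S is Gamma(3/2,β)-distributed and (X',Y') has the same joint law as (X,Y);
in particular X' is exponential(β), Y' has the tracer law, and X', Y' are
independent. -/
theorem stmt10 {Ω : Type*} [MeasurableSpace Ω] (μ : Measure Ω) [IsProbabilityMeasure μ]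
    (β : ℝ) (hβ : 0 < β) (X Y S Y' X' : Ω → ℝ)
    (hX : Measurable X) (hY : Measurable Y) (hY'm : Measurable Y')
    (hXlaw : Measure.map X μ = expLaw β) (hYlaw : Measure.map Y μ = tracerLaw β)
    (hXY : IndepFun X Y μ)
    (hS : S = fun ω => X ω + Y ω)
    (hX'def : X' = fun ω => S ω - Y' ω)
    (hcond : ∀ A B : Set ℝ, MeasurableSet A → MeasurableSet B →
      Measure.map (fun ω => (S ω, Y' ω)) μ (A ×ˢ B)
        = ∫⁻ s in A,
            ENNReal.ofReal (∫ y in B ∩ Set.Icc 0 s, 1 / (2 * Real.sqrt (y * s)))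
            ∂(Measure.map S μ)) :
    Measure.map S μ = gammaThreeHalfLaw β
    ∧ Measure.map (fun ω => (X' ω, Y' ω)) μ = Measure.map (fun ω => (X ω, Y ω)) μ
    ∧ Measure.map X' μ = expLaw β
    ∧ Measure.map Y' μ = tracerLaw β
    ∧ IndepFun X' Y' μ := by
  have hSm : Measurable S := by rw [hS]; exact hX.add hY
  have hJ := joint μ β hβ X Y hX hY hXlaw hYlaw hXY
  have hSlaw : Measure.map S μ = volume.withDensity (hD β) := by
    ext A hA
    have h := hJ A Set.univ hA MeasurableSet.univ
    rw [Measure.map_apply (by fun_prop) (hA.prod MeasurableSet.univ)] at h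
    rw [Measure.map_apply hSm hA, withDensity_apply _ hA]
    have e : S ⁻¹' A = (fun ω => (X ω + Y ω, Y ω)) ⁻¹' (A ×ˢ Set.univ) := by
      ext ω; simp [hS]
    rw [e, h]
    refine lintegral_congr fun s => ?_
    rcases le_or_gt s 0 with hs | hs
    · simp [hD, not_lt.2 hs]
    · rw [Set.univ_inter, kernel_mass s hs]; simp
  have hpair : Measure.map (fun ω => (S ω, Y' ω)) μ
      = Measure.map (fun ω => (X ω + Y ω, Y ω)) μ := by
    have : IsProbabilityMeasure (Measure.map (fun ω => (S ω, Y' ω)) μ) :=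
      Measure.isProbabilityMeasure_map (by fun_prop)
    refine Measure.ext_prod fun {A B} hA hB => ?_
    rw [hcond A B hA hB, hJ A B hA hB, hSlaw,
      setLIntegral_withDensity_eq_setLIntegral_mul_non_measurable _ (meas_hD β) _ hA
        (Filter.Eventually.of_forall fun s => ENNReal.ofReal_lt_top)]
    rfl
  have hmain : Measure.map (fun ω => (X' ω, Y' ω)) μ = Measure.map (fun ω => (X ω, Y ω)) μ := by
    have hR : Measurable (fun p : ℝ × ℝ => (p.1 - p.2, p.2)) := by fun_prop
    have h := congrArg (Measure.map (fun p : ℝ × ℝ => (p.1 - p.2, p.2))) hpair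
    rw [Measure.map_map hR (by fun_prop), Measure.map_map hR (by fun_prop)] at h
    simpa [Function.comp_def, hX'def] using h
  have hX'm : Measurable X' := by rw [hX'def]; exact hSm.sub hY'm
  have hX' : Measure.map X' μ = expLaw β := by
    have h := congrArg (Measure.map Prod.fst) hmain
    rw [Measure.map_map measurable_fst (by fun_prop),
      Measure.map_map measurable_fst (by fun_prop)] at h
    exact h.trans hXlaw
  have hY' : Measure.map Y' μ = tracerLaw β := by
    have h := congrArg (Measure.map Prod.snd) hmain
    rw [Measure.map_map measurable_snd (by fun_prop),
      Measure.map_map measurable_snd (by fun_prop)] at h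
    exact h.trans hYlaw
  refine ⟨hSlaw, hmain, hX', hY', ?_⟩
  rw [indepFun_iff_map_prod_eq_prod_map_map hX'm.aemeasurable hY'm.aemeasurable, hmain, hX', hY',
    ← hXlaw, ← hYlaw]
  exact (indepFun_iff_map_prod_eq_prod_map_map hX.aemeasurable hY.aemeasurable).1 hXY
end
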